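/- arXiv:2105.08339 — 3 statements merged into one kernel-verified Lean document; each statement's English description precedes it below -/
import Mathlib

section
/- For every dimension d ≥ 1, every nonzero x ∈ ℝ^d, and every real d×d orthogonal matrix R, the DRIVE estimate with the unbiased scale S = ‖x‖₂²/‖Rx‖₁ satisfies ‖x − Rᵀ(S·sign(Rx))‖₂² = ‖x‖₂²·(d/‖R x̆‖₁² − 1), where x̆ = x/‖x‖₂. (Note ‖Rx‖₁ ≥ ‖Rx‖₂ = ‖x‖₂ > 0, so S is well defined.) -/
open Matrix BigOperators

/-- Coordinatewise binary sign: `1` if the coordinate is nonnegative, `-1` otherwise. -/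
noncomputable def signVec {d : ℕ} (y : Fin d → ℝ) : Fin d → ℝ :=
  fun i => if 0 ≤ y i then 1 else -1

/-- DRIVE estimate `x̂ = Rᵀ (S • sign (R x))`. -/
noncomputable def driveEst {d : ℕ} (R : Matrix (Fin d) (Fin d) ℝ) (S : ℝ)
    (x : Fin d → ℝ) : Fin d → ℝ :=
  Rᵀ.mulVec (S • signVec (R.mulVec x))

/-- Multiplication by a matrix with orthonormal columns preserves the sum of squares. -/
theorem sum_sq_mulVec_of_transpose_mul_self {m n : Type*} [Fintype m] [Fintype n] [DecidableEq n]
    {A : Matrix m n ℝ} (hA : Aᵀ * A = 1) (v : n → ℝ) :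
    ∑ i, (A.mulVec v i) ^ 2 = ∑ i, (v i) ^ 2 := by
  have h : A.mulVec v ⬝ᵥ A.mulVec v = v ⬝ᵥ v := by
    rw [Matrix.dotProduct_mulVec, Matrix.vecMul_mulVec, hA, Matrix.vecMul_one]
  simpa [dotProduct, sq] using h

theorem sub_smul_signVec_sq {d : ℕ} (y : Fin d → ℝ) (S : ℝ) (i : Fin d) :
    (y i - S * signVec y i) ^ 2 = (y i) ^ 2 - 2 * S * |y i| + S ^ 2 := by
  unfold signVec
  split_ifs with h
  · rw [abs_of_nonneg h]; ring
  · rw [abs_of_neg (not_le.mp h)]; ring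

/-- The squared error of the DRIVE estimate, for an arbitrary scale. -/
theorem sum_sq_sub_driveEst {d : ℕ} (x : Fin d → ℝ) {R : Matrix (Fin d) (Fin d) ℝ}
    (hR : Rᵀ * R = 1) (S : ℝ) :
    ∑ i, (x i - driveEst R S x i) ^ 2
      = ∑ i, (x i) ^ 2 - 2 * S * ∑ i, |R.mulVec x i| + d * S ^ 2 := by
  have hR' : Rᵀᵀ * Rᵀ = 1 := by
    rw [Matrix.transpose_transpose]; exact mul_eq_one_comm.mp hR
  have key : ∀ i, x i - driveEst R S x i
      = Rᵀ.mulVec (R.mulVec x - S • signVec (R.mulVec x)) i := by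
    intro i
    rw [Matrix.mulVec_sub, Matrix.mulVec_mulVec, hR, Matrix.one_mulVec]
    rfl
  simp_rw [key]
  rw [sum_sq_mulVec_of_transpose_mul_self hR', ← sum_sq_mulVec_of_transpose_mul_self hR x]
  simp only [Pi.sub_apply, Pi.smul_apply, smul_eq_mul, sub_smul_signVec_sq,
    Finset.sum_add_distrib, Finset.sum_sub_distrib, ← Finset.mul_sum, Finset.sum_const,
    Finset.card_univ, Fintype.card_fin, nsmul_eq_mul]

theorem sum_abs_mulVec_div {m n : Type*} [Fintype m] [Fintype n] (A : Matrix m n ℝ)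
    (x : n → ℝ) {c : ℝ} (hc : 0 ≤ c) :
    ∑ i, |A.mulVec (fun j => x j / c) i| = (∑ i, |A.mulVec x i|) / c := by
  have h : (fun j => x j / c) = c⁻¹ • x := by
    ext j; simp [div_eq_inv_mul]
  rw [h, div_eq_inv_mul]
  simp only [Matrix.mulVec_smul, Pi.smul_apply, smul_eq_mul, abs_mul, abs_inv,
    abs_of_nonneg hc, ← Finset.mul_sum]

theorem drive_unbiased_scale_sse (d : ℕ) (hd : 1 ≤ d) (x : Fin d → ℝ) (hx : x ≠ 0)
    (R : Matrix (Fin d) (Fin d) ℝ) (hR : Rᵀ * R = 1) :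
    ∑ i, (x i - driveEst R ((∑ i, (x i) ^ 2) / (∑ i, |R.mulVec x i|)) x i) ^ 2
      = (∑ i, (x i) ^ 2) *
        ((d : ℝ) / (∑ i, |R.mulVec (fun j => x j / Real.sqrt (∑ i, (x i) ^ 2)) i|) ^ 2 - 1) := by
  have hN : 0 < ∑ i, (x i) ^ 2 := by
    obtain ⟨j, hj⟩ := Function.ne_iff.mp hx
    exact Finset.sum_pos' (fun i _ => sq_nonneg _) ⟨j, Finset.mem_univ j, sq_pos_of_ne_zero hj⟩
  have hL : ∑ i, |R.mulVec x i| ≠ 0 := by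
    intro h
    rw [Finset.sum_eq_zero_iff_of_nonneg fun i _ => abs_nonneg _] at h
    rw [← sum_sq_mulVec_of_transpose_mul_self hR x] at hN
    refine hN.ne' (Finset.sum_eq_zero fun i hi => ?_)
    rw [abs_eq_zero.mp (h i hi), sq, zero_mul]
  rw [sum_sq_sub_driveEst x hR, sum_abs_mulVec_div R x (Real.sqrt_nonneg _),
    div_pow _ (Real.sqrt _), Real.sq_sqrt hN.le]
  field_simp
  ring
end

section
/- Let μ be the Haar probability measure on the compact group O(d) of real d×d orthogonal matrices, d ≥ 1. For every nonzero x ∈ ℝ^d, the DRIVE estimate with scale S(x,R) = ‖x‖₂²/‖Rx‖₁ is unbiased: the Bochner integral ∫_{O(d)} Rᵀ·((‖x‖₂²/‖Rx‖₁)·sign(Rx)) dμ(R) equals x. -/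
open Matrix MeasureTheory BigOperators

/-- The (Borel) measurable structure on real matrices, obtained from the product
structure on `Fin d → Fin d → ℝ`. -/
instance matrixMeasurableSpace (d : ℕ) : MeasurableSpace (Matrix (Fin d) (Fin d) ℝ) :=
  inferInstanceAs (MeasurableSpace (Fin d → Fin d → ℝ))

section Measurability

variable {d : ℕ} {α : Type*} [MeasurableSpace α]

theorem measurable_matrix_iff {f : α → Matrix (Fin d) (Fin d) ℝ} :
    Measurable f ↔ ∀ i j, Measurable fun a => f a i j :=
  measurable_pi_iff.trans (forall_congr' fun _ => measurable_pi_iff)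

theorem measurable_matrix_mul {f g : α → Matrix (Fin d) (Fin d) ℝ}
    (hf : Measurable f) (hg : Measurable g) : Measurable fun a => f a * g a := by
  rw [measurable_matrix_iff] at *
  intro i j
  simp only [Matrix.mul_apply]
  exact Finset.measurable_sum _ fun k _ => (hf i k).mul (hg k j)

theorem measurable_matrix_transpose {f : α → Matrix (Fin d) (Fin d) ℝ}
    (hf : Measurable f) : Measurable fun a => (f a)ᵀ := by
  rw [measurable_matrix_iff] at *
  exact fun i j => hf j i

theorem measurable_matrix_mulVec {f : α → Matrix (Fin d) (Fin d) ℝ} {v : α → Fin d → ℝ}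
    (hf : Measurable f) (hv : Measurable v) : Measurable fun a => (f a).mulVec (v a) := by
  rw [measurable_matrix_iff] at hf
  rw [measurable_pi_iff] at *
  intro i
  simp only [Matrix.mulVec, dotProduct]
  exact Finset.measurable_sum _ fun k _ => (hf i k).mul (hv k)

theorem measurable_signVec : Measurable (signVec (d := d)) :=
  measurable_pi_iff.2 fun i =>
    Measurable.ite (measurableSet_le measurable_const (measurable_pi_apply i))
      measurable_const measurable_const

end Measurability

/-- A probability measure concentrated on the orthogonal group that is invariant under left
multiplication by orthogonal matrices is also invariant under right multiplication. -/
theorem map_mul_right_eq_self_of_orthogonal_left_invariant {d : ℕ}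
    (μ : Measure (Matrix (Fin d) (Fin d) ℝ)) [IsProbabilityMeasure μ]
    (hsupp : ∀ᵐ R ∂μ, Rᵀ * R = 1)
    (hinv : ∀ Q : Matrix (Fin d) (Fin d) ℝ, Qᵀ * Q = 1 →
      Measure.map (fun R => Q * R) μ = μ)
    {H : Matrix (Fin d) (Fin d) ℝ} (hH : Hᵀ * H = 1) :
    Measure.map (fun R => R * H) μ = μ := by
  have left_inv : ∀ Q : Matrix (Fin d) (Fin d) ℝ, Qᵀ * Q = 1 →
      ∀ f : Matrix (Fin d) (Fin d) ℝ → ENNReal, Measurable f →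
        ∫⁻ R, f (Q * R) ∂μ = ∫⁻ R, f R ∂μ := by
    intro Q hQ f hf
    conv_rhs => rw [← hinv Q hQ]
    exact (lintegral_map hf (measurable_matrix_mul measurable_const measurable_id)).symm
  have average : ∀ f : Matrix (Fin d) (Fin d) ℝ → ENNReal, Measurable f →
      ∫⁻ R, f R ∂μ = ∫⁻ R, ∫⁻ S, f (Sᵀ * R) ∂μ ∂μ := by
    intro f hf
    rw [lintegral_lintegral_swap]
    · calc ∫⁻ R, f R ∂μ = ∫⁻ _, ∫⁻ R, f R ∂μ ∂μ := by simp
        _ = _ := lintegral_congr_ae <| hsupp.mono fun S hS =>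
          (left_inv Sᵀ (by rw [transpose_transpose]; exact mul_eq_one_comm.1 hS) f hf).symm
    · exact (hf.comp (measurable_matrix_mul (measurable_matrix_transpose measurable_snd)
        measurable_fst)).aemeasurable
  have mul_meas : Measurable fun R : Matrix (Fin d) (Fin d) ℝ => R * H :=
    measurable_matrix_mul measurable_id measurable_const
  refine Measure.ext_of_lintegral _ fun f hf => ?_
  rw [lintegral_map hf mul_meas, average f hf,
    average (fun R => f (R * H)) (hf.comp mul_meas)]
  refine lintegral_congr_ae (hsupp.mono fun R hR => ?_)
  have hR' : R * Rᵀ = 1 := mul_eq_one_comm.1 hR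
  have hH' : H * Hᵀ = 1 := mul_eq_one_comm.1 hH
  have hQ : (R * Hᵀ * Rᵀ)ᵀ * (R * Hᵀ * Rᵀ) = 1 := by
    calc (R * Hᵀ * Rᵀ)ᵀ * (R * Hᵀ * Rᵀ) = R * (H * ((Rᵀ * R) * Hᵀ)) * Rᵀ := by
          simp only [transpose_mul, transpose_transpose, Matrix.mul_assoc]
      _ = 1 := by rw [hR, Matrix.one_mul, hH', Matrix.mul_one, hR']
  have key := left_inv _ hQ (fun S => f (Sᵀ * R))
    (hf.comp (measurable_matrix_mul (measurable_matrix_transpose measurable_id)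
      measurable_const))
  beta_reduce
  rw [← key]
  refine lintegral_congr fun S => ?_
  simp only [transpose_mul, transpose_transpose, Matrix.mul_assoc, hR, Matrix.mul_one]

section Estimate

variable {d : ℕ}

/-- The DRIVE estimate of `x` obtained from the matrix `R`. -/
noncomputable def driveEstimate (x : Fin d → ℝ) (R : Matrix (Fin d) (Fin d) ℝ) : Fin d → ℝ :=
  Rᵀ.mulVec (((∑ i, (x i) ^ 2) / (∑ i, |R.mulVec x i|)) • signVec (R.mulVec x))

theorem measurable_driveEstimate (x : Fin d → ℝ) : Measurable (driveEstimate x) := by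
  have hRx : Measurable fun R : Matrix (Fin d) (Fin d) ℝ => R.mulVec x :=
    measurable_matrix_mulVec measurable_id measurable_const
  refine measurable_matrix_mulVec (measurable_matrix_transpose measurable_id)
    (Measurable.fun_smul ?_ ?_)
  · exact measurable_const.div
      (Finset.measurable_sum _ fun i _ => ((measurable_pi_apply i).comp hRx).abs)
  · exact measurable_signVec.comp hRx

theorem sum_sq_pos {x : Fin d → ℝ} (hx : x ≠ 0) : 0 < ∑ i, (x i) ^ 2 := by
  obtain ⟨i, hi⟩ := Function.ne_iff.1 hx
  exact Finset.sum_pos' (fun _ _ => sq_nonneg _) ⟨i, Finset.mem_univ i, sq_pos_of_ne_zero hi⟩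

theorem sum_sq_mulVec {R : Matrix (Fin d) (Fin d) ℝ} (hR : Rᵀ * R = 1) (x : Fin d → ℝ) :
    ∑ i, (R.mulVec x i) ^ 2 = ∑ i, (x i) ^ 2 := by
  have h : R.mulVec x ⬝ᵥ R.mulVec x = x ⬝ᵥ x := by
    rw [dotProduct_mulVec, vecMul_mulVec, hR, vecMul_one]
  simpa only [dotProduct, ← sq] using h

theorem sum_sq_le_sq_sum_abs (y : Fin d → ℝ) : ∑ i, (y i) ^ 2 ≤ (∑ i, |y i|) ^ 2 := by
  simpa only [sq_abs] using
    Finset.sum_sq_le_sq_sum_of_nonneg (s := Finset.univ) fun i _ => abs_nonneg (y i)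

theorem sum_abs_mulVec_pos {R : Matrix (Fin d) (Fin d) ℝ} (hR : Rᵀ * R = 1)
    {x : Fin d → ℝ} (hx : x ≠ 0) : 0 < ∑ i, |R.mulVec x i| := by
  have h := sum_sq_le_sq_sum_abs (R.mulVec x)
  rw [sum_sq_mulVec hR] at h
  exact lt_of_le_of_ne (Finset.sum_nonneg fun _ _ => abs_nonneg _)
    fun h0 => by nlinarith [sum_sq_pos hx]

theorem abs_apply_le_one_of_orthogonal {R : Matrix (Fin d) (Fin d) ℝ} (hR : Rᵀ * R = 1)
    (i j : Fin d) : |R i j| ≤ 1 := by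
  have h : ∑ k, R k j * R k j = 1 := by
    simpa [Matrix.mul_apply] using congrFun (congrFun hR j) j
  rw [← sq_le_one_iff_abs_le_one, ← h, sq]
  exact Finset.single_le_sum (f := fun k => R k j * R k j)
    (fun k _ => mul_self_nonneg _) (Finset.mem_univ i)

theorem abs_signVec (y : Fin d → ℝ) (i : Fin d) : |signVec y i| = 1 := by
  unfold signVec
  split_ifs <;> simp

theorem signVec_mul_self (y : Fin d → ℝ) (i : Fin d) : signVec y i * y i = |y i| := by
  unfold signVec
  split_ifs with h
  · rw [abs_of_nonneg h, one_mul]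
  · rw [abs_of_neg (not_le.1 h), neg_one_mul]

theorem norm_driveEstimate_le {R : Matrix (Fin d) (Fin d) ℝ} (hR : Rᵀ * R = 1)
    {x : Fin d → ℝ} (hx : x ≠ 0) :
    ‖driveEstimate x R‖ ≤ d * √(∑ i, (x i) ^ 2) := by
  have hN := sum_abs_mulVec_pos hR hx
  have hle := sum_sq_le_sq_sum_abs (R.mulVec x)
  rw [sum_sq_mulVec hR] at hle
  have hT := sum_sq_pos hx
  have hscale : (∑ i, (x i) ^ 2) / (∑ i, |R.mulVec x i|) ≤ √(∑ i, (x i) ^ 2) := by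
    rw [div_le_iff₀ hN]
    calc _ = √(∑ i, (x i) ^ 2) * √(∑ i, (x i) ^ 2) := (Real.mul_self_sqrt hT.le).symm
      _ ≤ _ := mul_le_mul_of_nonneg_left (Real.sqrt_le_iff.2 ⟨hN.le, hle⟩) (Real.sqrt_nonneg _)
  refine (pi_norm_le_iff_of_nonneg (by positivity)).2 fun j => ?_
  rw [Real.norm_eq_abs, driveEstimate, Matrix.mulVec, dotProduct]
  refine (Finset.abs_sum_le_sum_abs _ _).trans ?_
  calc _ ≤ ∑ _i : Fin d, √(∑ i, (x i) ^ 2) := Finset.sum_le_sum fun i _ => ?_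
    _ = _ := by simp
  rw [Pi.smul_apply, smul_eq_mul, abs_mul, abs_mul, abs_signVec, mul_one, transpose_apply,
    abs_of_nonneg (div_nonneg hT.le hN.le)]
  exact (mul_le_of_le_one_left (div_nonneg hT.le hN.le)
    (abs_apply_le_one_of_orthogonal hR i j)).trans hscale

theorem dotProduct_driveEstimate {R : Matrix (Fin d) (Fin d) ℝ} (hR : Rᵀ * R = 1)
    {x : Fin d → ℝ} (hx : x ≠ 0) : x ⬝ᵥ driveEstimate x R = ∑ i, (x i) ^ 2 := by
  rw [driveEstimate, dotProduct_mulVec, vecMul_transpose, dotProduct_smul, dotProduct_comm,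
    smul_eq_mul]
  simp only [dotProduct, signVec_mul_self]
  exact div_mul_cancel₀ _ (sum_abs_mulVec_pos hR hx).ne'

theorem driveEstimate_mul_of_mulVec_eq_self {x : Fin d → ℝ} {H : Matrix (Fin d) (Fin d) ℝ}
    (hH : H.mulVec x = x) (R : Matrix (Fin d) (Fin d) ℝ) :
    driveEstimate x (R * H) = Hᵀ.mulVec (driveEstimate x R) := by
  simp only [driveEstimate, ← mulVec_mulVec, hH, transpose_mul]

/-- The matrix fixing `x` and acting as `-1` on its orthogonal complement. -/
noncomputable def lineReflection (x : Fin d → ℝ) : Matrix (Fin d) (Fin d) ℝ :=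
  (2 / ∑ i, (x i) ^ 2) • vecMulVec x x - 1

theorem lineReflection_mulVec (x y : Fin d → ℝ) :
    (lineReflection x).mulVec y = (2 / (∑ i, (x i) ^ 2) * (x ⬝ᵥ y)) • x - y := by
  rw [lineReflection, sub_mulVec, one_mulVec, smul_mulVec, vecMulVec_mulVec]
  ext i
  simp [mul_assoc, mul_comm]

theorem lineReflection_mulVec_self {x : Fin d → ℝ} (hx : x ≠ 0) :
    (lineReflection x).mulVec x = x := by
  have h : x ⬝ᵥ x = ∑ i, (x i) ^ 2 := by simp only [dotProduct, sq]
  rw [lineReflection_mulVec, h, div_mul_cancel₀ _ (sum_sq_pos hx).ne', two_smul,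
    add_sub_cancel_right]

theorem lineReflection_transpose (x : Fin d → ℝ) :
    (lineReflection x)ᵀ = lineReflection x := by
  simp [lineReflection, transpose_vecMulVec]

theorem lineReflection_orthogonal {x : Fin d → ℝ} (hx : x ≠ 0) :
    (lineReflection x)ᵀ * lineReflection x = 1 := by
  rw [lineReflection_transpose]
  refine ext_of_mulVec_single fun i => ?_
  rw [← mulVec_mulVec, lineReflection_mulVec x (Pi.single i 1), mulVec_sub, mulVec_smul,
    lineReflection_mulVec_self hx, lineReflection_mulVec, one_mulVec, sub_sub_cancel]

end Estimate

/-- `μ` is (the pushforward to matrix space of) the Haar probability measure on `O(d)`: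
it is a probability measure, concentrated on orthogonal matrices, and invariant under left
multiplication by any orthogonal matrix.  For any such `μ`, DRIVE with the unbiased scale
`S = ‖x‖₂² / ‖Rx‖₁` satisfies `E[x̂] = x`. -/
theorem drive_unbiased (d : ℕ) (hd : 1 ≤ d) (x : Fin d → ℝ) (hx : x ≠ 0)
    (μ : Measure (Matrix (Fin d) (Fin d) ℝ)) [IsProbabilityMeasure μ]
    (hsupp : ∀ᵐ R ∂μ, Rᵀ * R = 1)
    (hinv : ∀ Q : Matrix (Fin d) (Fin d) ℝ, Qᵀ * Q = 1 →
      Measure.map (fun R => Q * R) μ = μ) :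
    (∫ R, Rᵀ.mulVec
        (((∑ i, (x i) ^ 2) / (∑ i, |R.mulVec x i|)) • signVec (R.mulVec x)) ∂μ) = x := by
  change ∫ R, driveEstimate x R ∂μ = x
  have hmeas := measurable_driveEstimate x
  have hint : Integrable (driveEstimate x) μ :=
    .of_bound hmeas.aestronglyMeasurable _ (hsupp.mono fun R hR => norm_driveEstimate_le hR hx)
  have hdot : x ⬝ᵥ ∫ R, driveEstimate x R ∂μ = ∑ i, (x i) ^ 2 := by
    calc x ⬝ᵥ ∫ R, driveEstimate x R ∂μ = ∫ R, x ⬝ᵥ driveEstimate x R ∂μ :=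
          ((dotProductBilin ℝ ℝ x).toContinuousLinearMap.integral_comp_comm hint).symm
      _ = ∫ _, ∑ i, (x i) ^ 2 ∂μ :=
          integral_congr_ae (hsupp.mono fun R hR => dotProduct_driveEstimate hR hx)
      _ = _ := by simp
  have hfix : (lineReflection x).mulVec (∫ R, driveEstimate x R ∂μ)
      = ∫ R, driveEstimate x R ∂μ := by
    calc _ = ∫ R, (lineReflection x).mulVec (driveEstimate x R) ∂μ :=
          ((lineReflection x).mulVecLin.toContinuousLinearMap.integral_comp_comm hint).symm
      _ = ∫ R, driveEstimate x (R * lineReflection x) ∂μ := by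
          simp only [driveEstimate_mul_of_mulVec_eq_self (lineReflection_mulVec_self hx),
            lineReflection_transpose]
      _ = ∫ R, driveEstimate x R ∂(μ.map fun R => R * lineReflection x) :=
          (integral_map (measurable_matrix_mul measurable_id measurable_const).aemeasurable
            hmeas.aestronglyMeasurable).symm
      _ = _ := by
          rw [map_mul_right_eq_self_of_orthogonal_left_invariant μ hsupp hinv
            (lineReflection_orthogonal hx)]
  rw [lineReflection_mulVec, hdot, div_mul_cancel₀ _ (sum_sq_pos hx).ne', sub_eq_iff_eq_add,
    ← two_smul ℝ] at hfix
  exact (smul_right_injective _ (two_ne_zero (α := ℝ)) hfix).symm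
end

section
/- For every dimension d ≥ 2, the standard Gaussian vector Z in ℝ^d satisfies E[d·‖Z‖₂²/‖Z‖₁²] − 1 ≤ 2.92. (The random variable d·‖Z‖₂²/‖Z‖₁² is bounded above by d since ‖Z‖₂ ≤ ‖Z‖₁, hence integrable; it has the same distribution as d/‖T‖₁² for T uniform on S^{d−1}, so this bounds the vNMSE of unbiased DRIVE with a uniform random rotation.) -/
open MeasureTheory BigOperators

/-- The law of a standard Gaussian vector in `ℝ^d`: the product of `d` standard
normal distributions. -/
noncomputable def stdGaussian (d : ℕ) : Measure (Fin d → ℝ) :=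
  Measure.pi fun _ => ProbabilityTheory.gaussianReal 0 1

open Real Set
open ProbabilityTheory (gaussianReal gaussianPDFReal integral_gaussianReal_eq_integral_smul
  memLp_id_gaussianReal)

/-- Integrals of even functions against the standard normal law, as half-line integrals. -/
lemma integral_comp_abs_gaussianReal (f : ℝ → ℝ) :
    ∫ x, f |x| ∂gaussianReal 0 1 = √(2 / π) * ∫ x in Ioi (0 : ℝ), f x * exp (-x ^ 2 / 2) := by
  have h : ∀ x : ℝ, gaussianPDFReal 0 1 x • f |x|
      = (fun y => (√(2 * π))⁻¹ * (f y * exp (-y ^ 2 / 2))) |x| := by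
    intro x
    simp only [gaussianPDFReal, smul_eq_mul, sq_abs, NNReal.coe_one, mul_one, sub_zero]
    ring
  rw [integral_gaussianReal_eq_integral_smul one_ne_zero]
  simp_rw [h]
  rw [integral_comp_abs (f := fun y => (√(2 * π))⁻¹ * (f y * exp (-y ^ 2 / 2))),
    integral_const_mul, ← mul_assoc]
  congr 1
  have h2 : √2 * √2 = 2 := mul_self_sqrt (by norm_num)
  rw [sqrt_mul (by norm_num), sqrt_div (by norm_num)]
  field_simp
  linarith

lemma integrable_abs_pow_gaussianReal (k : ℕ) :
    Integrable (fun x : ℝ => |x| ^ k) (gaussianReal 0 1) := by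
  have h := (memLp_id_gaussianReal (μ := 0) (v := 1) k).integrable_norm_pow'
  simpa using h

lemma integral_abs_pow_gaussianReal_add_two (k : ℕ) :
    ∫ x, |x| ^ (k + 2) ∂gaussianReal 0 1 = (k + 1) * ∫ x, |x| ^ k ∂gaussianReal 0 1 := by
  have key : ∀ n : ℕ, ∫ x in Ioi (0 : ℝ), x ^ n * exp (-x ^ 2 / 2)
      = (1 / 2 : ℝ) ^ (-((n : ℝ) + 1) / 2) * (1 / 2) * Gamma (((n : ℝ) + 1) / 2) := by
    intro n
    rw [← integral_rpow_mul_exp_neg_mul_rpow (by norm_num) (by linarith [n.cast_nonneg (α := ℝ)])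
      (by norm_num)]
    refine setIntegral_congr_fun measurableSet_Ioi fun x _ => ?_
    simp only [rpow_natCast, rpow_ofNat]
    congr 2
    ring
  rw [integral_comp_abs_gaussianReal (fun x => x ^ (k + 2)),
    integral_comp_abs_gaussianReal (fun x => x ^ k), key, key]
  have hk : ((k : ℝ) + 1) / 2 ≠ 0 := by positivity
  push_cast
  rw [show ((k : ℝ) + 2 + 1) / 2 = (k + 1) / 2 + 1 by ring, Gamma_add_one hk,
    show -((k : ℝ) + 2 + 1) / 2 = -(k + 1) / 2 + (-1) by ring, rpow_add (by norm_num),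
    rpow_neg_one]
  ring

lemma integral_abs_gaussianReal :
    ∫ x, |x| ^ 1 ∂gaussianReal 0 1 = √(2 / π) := by
  rw [integral_comp_abs_gaussianReal (fun x => x ^ 1)]
  have h := integral_rpow_mul_exp_neg_mul_rpow (p := 2) (q := 1) (b := 1 / 2)
    (by norm_num) (by norm_num) (by norm_num)
  norm_num at h
  have h' : ∫ x in Ioi (0 : ℝ), x ^ 1 * exp (-x ^ 2 / 2) = 1 := by
    rw [← h]
    refine setIntegral_congr_fun measurableSet_Ioi fun x _ => ?_
    simp only [pow_one]
    congr 2
    ring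
  rw [h', mul_one]

lemma exp_neg_le_quartic {y : ℝ} (hy : 0 ≤ y) :
    exp (-y) ≤ 1 - y + y ^ 2 / 2 - y ^ 3 / 6 + y ^ 4 / 24 := by
  have h := sum_le_exp_of_nonneg hy 5
  simp only [Finset.sum_range_succ, Finset.sum_range_zero, Nat.factorial] at h
  norm_num at h
  have hp : 0 ≤ 1 - y + y ^ 2 / 2 - y ^ 3 / 6 + y ^ 4 / 24 := by
    nlinarith [sq_nonneg (y ^ 2 - 2 * y), sq_nonneg (y - 1)]
  have h1 : 1 ≤ (1 - y + y ^ 2 / 2 - y ^ 3 / 6 + y ^ 4 / 24) * exp y := by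
    refine le_trans ?_ (mul_le_mul_of_nonneg_left h hp)
    nlinarith [pow_nonneg hy 6, pow_nonneg hy 8]
  rw [exp_neg, inv_le_iff_one_le_mul₀ (exp_pos y)]
  exact h1

lemma integrable_abs_pow_mul_exp_gaussianReal (k : ℕ) {t : ℝ} (ht : 0 ≤ t) :
    Integrable (fun x : ℝ => |x| ^ k * exp (-(t * |x|))) (gaussianReal 0 1) := by
  refine (integrable_abs_pow_gaussianReal k).mono' (by fun_prop) (.of_forall fun x => ?_)
  rw [norm_of_nonneg (by positivity)]
  refine mul_le_of_le_one_right (by positivity) (exp_le_one_iff.2 ?_)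
  have := mul_nonneg ht (abs_nonneg x)
  linarith

lemma integral_abs_pow_mul_exp_gaussianReal_le_quartic (k : ℕ) {t : ℝ} (ht : 0 ≤ t) :
    ∫ x, |x| ^ k * exp (-(t * |x|)) ∂gaussianReal 0 1 ≤
      ∫ x, |x| ^ k ∂gaussianReal 0 1 - t * ∫ x, |x| ^ (k + 1) ∂gaussianReal 0 1
      + t ^ 2 / 2 * ∫ x, |x| ^ (k + 2) ∂gaussianReal 0 1
      - t ^ 3 / 6 * ∫ x, |x| ^ (k + 3) ∂gaussianReal 0 1
      + t ^ 4 / 24 * ∫ x, |x| ^ (k + 4) ∂gaussianReal 0 1 := by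
  have hi := integrable_abs_pow_gaussianReal
  simp_rw [← integral_const_mul]
  have e0 := hi k
  have e1 := (hi (k + 1)).const_mul t
  have e2 := (hi (k + 2)).const_mul (t ^ 2 / 2)
  have e3 := (hi (k + 3)).const_mul (t ^ 3 / 6)
  have e4 := (hi (k + 4)).const_mul (t ^ 4 / 24)
  rw [← integral_sub' e0 e1, ← integral_add' (e0.sub e1) e2,
    ← integral_sub' ((e0.sub e1).add e2) e3, ← integral_add' (((e0.sub e1).add e2).sub e3) e4]
  refine integral_mono (integrable_abs_pow_mul_exp_gaussianReal k ht)
    ((((e0.sub e1).add e2).sub e3).add e4) fun x => ?_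
  have h := mul_le_mul_of_nonneg_left (exp_neg_le_quartic (mul_nonneg ht (abs_nonneg x)))
    (pow_nonneg (abs_nonneg x) k)
  refine h.trans_eq ?_
  simp only [Pi.add_apply, Pi.sub_apply]
  ring

lemma integral_abs_pow_mul_exp_gaussianReal_le_factorial (k : ℕ) {t s : ℝ} (hts : 0 < t + s) :
    ∫ x, |x| ^ k * exp (-(t * |x|)) ∂gaussianReal 0 1 ≤
      √(2 / π) * exp (s ^ 2 / 2) * k.factorial / (t + s) ^ (k + 1) := by
  rw [integral_comp_abs_gaussianReal (fun x => x ^ k * exp (-(t * x))), mul_assoc, mul_div_assoc]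
  refine mul_le_mul_of_nonneg_left ?_ (sqrt_nonneg _)
  have hk : (0 : ℝ) < k + 1 := by positivity
  have h := integral_rpow_mul_exp_neg_mul_Ioi hk hts
  have hint := integrableOn_rpow_mul_exp_neg_mul_rpow (p := 1) (s := k) (b := t + s)
    (by linarith) one_pos hts
  simp only [add_sub_cancel_right, rpow_natCast, rpow_one] at h hint
  rw [Gamma_nat_eq_factorial] at h
  have h' : exp (s ^ 2 / 2) * k.factorial / (t + s) ^ (k + 1)
      = ∫ x in Ioi (0 : ℝ), exp (s ^ 2 / 2) * (x ^ k * exp (-((t + s) * x))) := by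
    rw [integral_const_mul, h, ← Nat.cast_add_one, rpow_natCast, one_div, inv_pow]
    ring
  rw [h']
  refine integral_mono_of_nonneg ?_ ?_ ?_
  · filter_upwards [ae_restrict_mem measurableSet_Ioi] with x hx
    have : 0 < x := hx
    positivity
  · simpa only [neg_mul] using hint.const_mul (exp (s ^ 2 / 2))
  · filter_upwards [ae_restrict_mem measurableSet_Ioi] with x hx
    have hx : 0 < x := hx
    rw [mul_assoc, mul_left_comm (exp (s ^ 2 / 2)), ← exp_add, ← exp_add]
    refine mul_le_mul_of_nonneg_left (exp_le_exp.2 ?_) (by positivity)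
    nlinarith [sq_nonneg (x - s)]

lemma sqrt_two_div_pi_bounds : 0.797 < √(2 / π) ∧ √(2 / π) < 0.798 := by
  have h1 := pi_gt_d4
  have h2 := pi_lt_d4
  constructor
  · rw [lt_sqrt (by norm_num), lt_div_iff₀ pi_pos]
    nlinarith
  · rw [sqrt_lt' (by norm_num), div_lt_iff₀ pi_pos]
    nlinarith

lemma integral_exp_neg_abs_gaussianReal_le {t : ℝ} (ht : 0 ≤ t) :
    ∫ x, exp (-(t * |x|)) ∂gaussianReal 0 1 ≤ (1 + 3 / 5 * t)⁻¹ := by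
  obtain ⟨c1, c2⟩ := sqrt_two_div_pi_bounds
  rw [← one_div, le_div_iff₀ (by positivity)]
  rcases le_total t 1 with h | h
  · have hq := integral_abs_pow_mul_exp_gaussianReal_le_quartic 0 ht
    have m2 := integral_abs_pow_gaussianReal_add_two 0
    have m3 := integral_abs_pow_gaussianReal_add_two 1
    have m4 := integral_abs_pow_gaussianReal_add_two 2
    simp only [zero_add, pow_zero, one_mul, integral_const, probReal_univ, smul_eq_mul,
      Nat.reduceAdd, integral_abs_gaussianReal] at hq m2 m3 m4
    rw [m4, m3, m2] at hq
    push_cast at hq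
    set c := √(2 / π)
    refine (mul_le_mul_of_nonneg_right hq (by positivity)).trans ?_
    have hp : (0.6 - c) + (0.5 - 0.6 * c) * t + (0.3 - c / 3) * t ^ 2 + (1 / 8 - 0.2 * c) * t ^ 3
        + 0.075 * t ^ 4 ≤ 0 := by
      have t2 : t ^ 2 ≤ 1 := pow_le_one₀ ht h
      have t4 : t ^ 4 ≤ 1 := pow_le_one₀ ht h
      have a1 := mul_nonneg ht (sub_nonneg.2 c1.le)
      have a2 := mul_nonneg (sq_nonneg t) (sub_nonneg.2 c1.le)
      have a3 := mul_nonneg (pow_nonneg ht 3) (sub_nonneg.2 c1.le)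
      nlinarith [pow_nonneg ht 3]
    nlinarith [mul_nonneg ht (neg_nonneg.2 hp)]
  · have hq := integral_abs_pow_mul_exp_gaussianReal_le_factorial 0 (t := t) (s := 0.6)
      (by linarith)
    simp only [zero_add, pow_zero, one_mul, Nat.factorial_zero, Nat.cast_one, mul_one,
      pow_one] at hq
    have he : exp (0.6 ^ 2 / 2) ≤ 1.25 := by
      have := exp_bound_div_one_sub_of_interval (x := 0.18) (by norm_num) (by norm_num)
      norm_num at this ⊢
      linarith
    have hc : √(2 / π) * exp (0.6 ^ 2 / 2) ≤ 0.798 * 1.25 := by gcongr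
    refine (mul_le_mul_of_nonneg_right hq (by positivity)).trans ?_
    rw [div_mul_eq_mul_div, div_le_one (by positivity)]
    nlinarith

lemma integral_sq_mul_exp_neg_abs_gaussianReal_le {t : ℝ} (ht : 0 ≤ t) :
    ∫ x, |x| ^ 2 * exp (-(t * |x|)) ∂gaussianReal 0 1 ≤ (1 + 3 / 5 * t)⁻¹ ^ 2 := by
  obtain ⟨c1, c2⟩ := sqrt_two_div_pi_bounds
  rw [inv_pow, ← one_div, le_div_iff₀ (by positivity)]
  rcases le_total t 0.7 with h | h
  · have hq := integral_abs_pow_mul_exp_gaussianReal_le_quartic 2 ht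
    have m2 := integral_abs_pow_gaussianReal_add_two 0
    have m3 := integral_abs_pow_gaussianReal_add_two 1
    have m4 := integral_abs_pow_gaussianReal_add_two 2
    have m5 := integral_abs_pow_gaussianReal_add_two 3
    have m6 := integral_abs_pow_gaussianReal_add_two 4
    simp only [zero_add, pow_zero, integral_const, probReal_univ, smul_eq_mul,
      Nat.reduceAdd, integral_abs_gaussianReal] at hq m2 m3 m4 m5 m6
    rw [m6, m5, m4, m3, m2] at hq
    push_cast at hq
    set c := √(2 / π)
    refine (mul_le_mul_of_nonneg_right hq (by positivity)).trans ?_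
    have hp : (1.2 - 2 * c) + (1.86 - 2.4 * c) * t + (1.8 - 4 / 3 * c - 0.72 * c) * t ^ 2
        + (0.625 - 1.6 * c + 0.54) * t ^ 3 + (0.75 - 0.48 * c) * t ^ 4
        + 0.225 * t ^ 5 ≤ 0 := by
      have t2 : t ^ 2 ≤ 0.7 ^ 2 := pow_le_pow_left₀ ht h 2
      have t4 : t ^ 4 ≤ 0.7 ^ 4 := pow_le_pow_left₀ ht h 4
      have t5 : t ^ 5 ≤ 0.7 ^ 5 := pow_le_pow_left₀ ht h 5
      have a1 := mul_nonneg ht (sub_nonneg.2 c1.le)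
      have a2 := mul_nonneg (sq_nonneg t) (sub_nonneg.2 c1.le)
      have a3 := mul_nonneg (pow_nonneg ht 3) (sub_nonneg.2 c1.le)
      have a4 := mul_nonneg (pow_nonneg ht 4) (sub_nonneg.2 c1.le)
      nlinarith [pow_nonneg ht 3]
    nlinarith [mul_nonneg ht (neg_nonneg.2 hp)]
  · have hq := integral_abs_pow_mul_exp_gaussianReal_le_factorial 2 (t := t) (s := 1.4)
      (by linarith)
    have he : exp (1.4 ^ 2 / 2) ≤ 2.7183 := by
      refine (exp_le_exp.2 (by norm_num)).trans (exp_one_lt_d9.le.trans (by norm_num))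
    have hc : √(2 / π) * exp (1.4 ^ 2 / 2) ≤ 0.798 * 2.7183 := by gcongr
    refine (mul_le_mul_of_nonneg_right hq (by positivity)).trans ?_
    rw [div_mul_eq_mul_div, div_le_one (by positivity)]
    norm_num [Nat.factorial] at hc ⊢
    have hpoly : 4.3386 * (1 + 3 / 5 * t) ^ 2 ≤ (t + 7 / 5) ^ 3 := by
      nlinarith [mul_nonneg (sub_nonneg.2 h) (sub_nonneg.2 h),
        mul_nonneg (mul_nonneg (sub_nonneg.2 h) (sub_nonneg.2 h)) (sub_nonneg.2 h)]
    refine le_trans ?_ hpoly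
    refine mul_le_mul_of_nonneg_right ?_ (by positivity)
    linarith

lemma integral_Ioi_mul_exp_neg {a : ℝ} (ha : 0 < a) :
    ∫ t in Ioi (0 : ℝ), t * exp (-(t * a)) = (a ^ 2)⁻¹ := by
  have h := integral_rpow_mul_exp_neg_mul_Ioi (a := 2) two_pos ha
  norm_num [Gamma_two] at h
  simpa only [mul_comm a] using h

lemma integrableOn_Ioi_mul_exp_neg {a : ℝ} (ha : 0 < a) :
    IntegrableOn (fun t : ℝ => t * exp (-(t * a))) (Ioi 0) := by
  refine Integrable.of_integral_ne_zero ?_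
  rw [integral_Ioi_mul_exp_neg ha]
  positivity

/-- The integral over `t > 0` of `t / (1 + a t) ^ (n + 3)`. -/
lemma lintegral_Ioi_mul_inv_pow {a : ℝ} (ha : 0 < a) (n : ℕ) :
    ∫⁻ t in Ioi (0 : ℝ), ENNReal.ofReal (t * (1 + a * t)⁻¹ ^ (n + 3)) =
      ENNReal.ofReal ((a ^ 2 * (n + 1) * (n + 2))⁻¹) := by
  have hpos : ∀ t ∈ Ici (0 : ℝ), 0 < 1 + a * t := fun t ht => by
    have : 0 ≤ t := ht
    positivity
  let g : ℝ → ℝ := fun t =>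
    (a ^ 2)⁻¹ * ((1 + a * t)⁻¹ ^ (n + 2) / (n + 2) - (1 + a * t)⁻¹ ^ (n + 1) / (n + 1))
  have hderiv : ∀ t ∈ Ici (0 : ℝ), HasDerivAt g (t * (1 + a * t)⁻¹ ^ (n + 3)) t := by
    intro t ht
    have hne := (hpos t ht).ne'
    have h1 : HasDerivAt (fun t : ℝ => (1 + a * t)⁻¹) (-a / (1 + a * t) ^ 2) t := by
      simpa using (((hasDerivAt_id t).const_mul a).const_add 1).fun_inv hne
    have h := (((h1.fun_pow (n + 2)).div_const ((n : ℝ) + 2)).fun_sub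
      ((h1.fun_pow (n + 1)).div_const ((n : ℝ) + 1))).const_mul (a ^ 2)⁻¹
    refine h.congr_deriv ?_
    have hu : (1 + a * t)⁻¹ * (1 + a * t) = 1 := inv_mul_cancel₀ hne
    rw [div_eq_mul_inv (-a), ← inv_pow (1 + a * t)]
    generalize (1 + a * t)⁻¹ = u at hu
    rw [show n + 2 - 1 = n + 1 by lia, Nat.add_one_sub_one]
    push_cast
    have : (n : ℝ) + 1 ≠ 0 := by positivity
    have : (n : ℝ) + 2 ≠ 0 := by positivity
    field_simp
    linear_combination (-u ^ (n + 2)) * hu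
  have hnonneg : ∀ t ∈ Ioi (0 : ℝ), 0 ≤ t * (1 + a * t)⁻¹ ^ (n + 3) := fun t ht => by
    have : 0 < t := ht
    positivity
  have hlim : Filter.Tendsto g Filter.atTop (nhds 0) := by
    have h1 : Filter.Tendsto (fun t : ℝ => (1 + a * t)⁻¹) Filter.atTop (nhds 0) :=
      (Filter.tendsto_atTop_add_const_left _ _
        (Filter.tendsto_id.const_mul_atTop ha)).inv_tendsto_atTop
    have h := (((h1.pow (n + 2)).div_const ((n : ℝ) + 2)).sub
      ((h1.pow (n + 1)).div_const ((n : ℝ) + 1))).const_mul (a ^ 2)⁻¹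
    simpa [g] using h
  rw [← ofReal_integral_eq_lintegral_ofReal (integrableOn_Ioi_deriv_of_nonneg' hderiv hnonneg hlim)
    ((ae_restrict_mem measurableSet_Ioi).mono hnonneg),
    integral_Ioi_of_hasDerivAt_of_nonneg' hderiv hnonneg hlim]
  congr 1
  have : (n : ℝ) + 1 ≠ 0 := by positivity
  have : (n : ℝ) + 2 ≠ 0 := by positivity
  simp only [g, mul_zero, add_zero, inv_one, one_pow]
  field_simp
  ring

lemma sq_mul_exp_neg_sum_abs_eq_prod {d : ℕ} (i : Fin d) (t : ℝ) (z : Fin d → ℝ) :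
    z i ^ 2 * exp (-(t * ∑ j, |z j|)) =
      ∏ j, |z j| ^ (if j = i then 2 else 0) * exp (-(t * |z j|)) := by
  rw [Finset.prod_mul_distrib, ← exp_sum, Finset.sum_neg_distrib, ← Finset.mul_sum]
  simp [pow_ite]

lemma integrable_sq_mul_exp_neg_sum_abs {d : ℕ} (i : Fin d) {t : ℝ} (ht : 0 ≤ t) :
    Integrable (fun z : Fin d → ℝ => z i ^ 2 * exp (-(t * ∑ j, |z j|))) (stdGaussian d) := by
  simp_rw [sq_mul_exp_neg_sum_abs_eq_prod]
  exact Integrable.fintype_prod (f := fun j x => |x| ^ (if j = i then 2 else 0) * exp (-(t * |x|)))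
    fun j => integrable_abs_pow_mul_exp_gaussianReal _ ht

lemma integral_sq_mul_exp_neg_sum_abs_le {d : ℕ} (i : Fin d) {t : ℝ} (ht : 0 ≤ t) :
    ∫ z : Fin d → ℝ, z i ^ 2 * exp (-(t * ∑ j, |z j|)) ∂stdGaussian d ≤
      (1 + 3 / 5 * t)⁻¹ ^ (d + 1) := by
  simp_rw [sq_mul_exp_neg_sum_abs_eq_prod]
  rw [stdGaussian, integral_fintype_prod_eq_prod
    (fun j x => |x| ^ (if j = i then 2 else 0) * exp (-(t * |x|)))]
  calc _ ≤ ∏ j : Fin d, (1 + 3 / 5 * t)⁻¹ ^ (if j = i then 2 else 1) := by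
        refine Finset.prod_le_prod (fun j _ => integral_nonneg fun x => by positivity)
          fun j _ => ?_
        split_ifs
        · exact integral_sq_mul_exp_neg_abs_gaussianReal_le ht
        · simpa using integral_exp_neg_abs_gaussianReal_le ht
    _ = (1 + 3 / 5 * t)⁻¹ ^ (d + 1) := by
        have h : ∀ j : Fin d, (if j = i then 2 else 1) = 1 + (if j = i then 1 else 0) :=
          fun j => by split_ifs <;> rfl
        rw [Finset.prod_pow_eq_pow_sum]
        simp [h, Finset.sum_add_distrib]

lemma ofReal_ratio_le_lintegral {d : ℕ} (z : Fin d → ℝ) :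
    ENNReal.ofReal ((d : ℝ) * (∑ i, z i ^ 2) / (∑ i, |z i|) ^ 2) ≤
      ∫⁻ t in Ioi (0 : ℝ), ENNReal.ofReal (d * t * ∑ i, z i ^ 2 * exp (-(t * ∑ j, |z j|))) := by
  rcases (Finset.sum_nonneg fun i _ => abs_nonneg (z i) :
    0 ≤ ∑ i, |z i|).eq_or_lt with h | h
  · simp [← h]
  have heq : ∀ t : ℝ, d * t * ∑ i, z i ^ 2 * exp (-(t * ∑ j, |z j|)) =
      d * (∑ i, z i ^ 2) * (t * exp (-(t * ∑ j, |z j|))) := fun t => by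
    rw [← Finset.sum_mul]
    ring
  simp_rw [heq]
  rw [← ofReal_integral_eq_lintegral_ofReal ((integrableOn_Ioi_mul_exp_neg h).const_mul _),
    integral_const_mul, integral_Ioi_mul_exp_neg h, div_eq_mul_inv]
  filter_upwards [ae_restrict_mem measurableSet_Ioi] with t ht
  have : 0 < t := ht
  have : 0 ≤ ∑ i, z i ^ 2 := Finset.sum_nonneg fun i _ => sq_nonneg _
  positivity

instance isProbabilityMeasure_stdGaussian (d : ℕ) : IsProbabilityMeasure (stdGaussian d) := by
  unfold stdGaussian
  infer_instance

lemma lintegral_ratio_le {d : ℕ} (hd : 2 ≤ d) :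
    ∫⁻ z, ENNReal.ofReal ((d : ℝ) * (∑ i, z i ^ 2) / (∑ i, |z i|) ^ 2) ∂stdGaussian d ≤
      ENNReal.ofReal (25 / 9 * (d / (d - 1))) := by
  obtain ⟨n, rfl⟩ := Nat.exists_eq_add_of_le' hd
  refine (lintegral_mono fun z => ofReal_ratio_le_lintegral z).trans ?_
  rw [lintegral_lintegral_swap (Measurable.aemeasurable (by fun_prop))]
  calc _ ≤ ∫⁻ t in Ioi (0 : ℝ), ENNReal.ofReal (((n + 2 : ℕ) : ℝ) ^ 2) *
        ENNReal.ofReal (t * (1 + 3 / 5 * t)⁻¹ ^ (n + 3)) := by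
        refine setLIntegral_mono' measurableSet_Ioi fun t ht => ?_
        have ht : 0 < t := ht
        have hint : Integrable (fun z : Fin (n + 2) → ℝ =>
            ((n + 2 : ℕ) : ℝ) * t * ∑ i, z i ^ 2 * exp (-(t * ∑ j, |z j|)))
            (stdGaussian (n + 2)) :=
          (integrable_finsetSum _ fun i _ =>
            integrable_sq_mul_exp_neg_sum_abs i ht.le).const_mul _
        rw [← ofReal_integral_eq_lintegral_ofReal hint (.of_forall fun z => by positivity),
          ← ENNReal.ofReal_mul (by positivity), integral_const_mul,
          integral_finsetSum _ fun i _ => integrable_sq_mul_exp_neg_sum_abs i ht.le]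
        refine ENNReal.ofReal_le_ofReal ?_
        have hsum := Finset.sum_le_card_nsmul Finset.univ _ _
          fun i _ => integral_sq_mul_exp_neg_sum_abs_le (d := n + 2) i ht.le
        refine (mul_le_mul_of_nonneg_left hsum (by positivity)).trans_eq ?_
        simp only [Finset.card_univ, Fintype.card_fin, nsmul_eq_mul]
        ring
    _ = _ := by
        rw [lintegral_const_mul _ (by fun_prop), lintegral_Ioi_mul_inv_pow (by norm_num),
          ← ENNReal.ofReal_mul (by positivity)]
        congr 1
        have : (n : ℝ) + 1 ≠ 0 := by positivity
        have : (n : ℝ) + 2 ≠ 0 := by positivity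
        push_cast
        rw [show (n : ℝ) + 2 - 1 = n + 1 by ring]
        field_simp
        ring

lemma ratio_le_dim {d : ℕ} (z : Fin d → ℝ) :
    (d : ℝ) * (∑ i, z i ^ 2) / (∑ i, |z i|) ^ 2 ≤ d := by
  have h : ∑ i, z i ^ 2 ≤ (∑ i, |z i|) ^ 2 := by
    simpa only [sq_abs] using
      Finset.sum_sq_le_sq_sum_of_nonneg fun i (_ : i ∈ Finset.univ) => abs_nonneg (z i)
  rw [mul_div_assoc]
  exact mul_le_of_le_one_right (by positivity) (div_le_one_of_le₀ h (sq_nonneg _))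

theorem unbiased_drive_vNMSE_le (d : ℕ) (hd : 2 ≤ d) :
    (∫ z, (d : ℝ) * (∑ i, (z i) ^ 2) / (∑ i, |z i|) ^ 2 ∂stdGaussian d) - 1
      ≤ 2.92 := by
  rw [sub_le_iff_le_add, integral_eq_lintegral_of_nonneg_ae (.of_forall fun z => by positivity)
    (Measurable.aestronglyMeasurable (by fun_prop))]
  refine ENNReal.toReal_le_of_le_ofReal (by norm_num) ?_
  rcases Nat.lt_or_ge d 4 with h | h
  · have h3 : (d : ℝ) ≤ 3 := by exact_mod_cast Nat.le_of_lt_succ h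
    refine (lintegral_mono fun z => ENNReal.ofReal_le_ofReal (ratio_le_dim z)).trans ?_
    rw [lintegral_const, measure_univ, mul_one]
    exact ENNReal.ofReal_le_ofReal (by linarith)
  · have h4 : (4 : ℝ) ≤ d := by exact_mod_cast h
    refine (lintegral_ratio_le hd).trans (ENNReal.ofReal_le_ofReal ?_)
    have : (d : ℝ) / (d - 1) ≤ 4 / 3 := by
      rw [div_le_div_iff₀ (by linarith) (by norm_num)]
      linarith
    linarith
end
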